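/- Let V be a 6-dimensional F-vector space (char F ≠ 2,3) with non-degenerate Ω ∈ Λ²V*. For every θ ∈ Λ³V*, the characteristic polynomial of the endomorphism L_θ = i_{v_θ}J^θ has the form det(xI - L_θ) = x⁶ + c₄(θ)x⁴ + c₂(θ)x², i.e., the coefficients of x⁵, x³, x¹ and x⁰ all vanish; moreover c₂(θ) = (c₄(θ))²/4, equivalently with I₁ := -2·3²·c₄(θ) one has c₂(θ) = I₁²/(2⁴·3⁴). -/

import Mathlib

open scoped TensorProduct

/-- The wedge product of two alternating forms. -/
noncomputable def wedgeForm {F V : Type*} [CommRing F] [AddCommGroup V] [Module F V]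
    {m n : ℕ} (ω : V [⋀^Fin m]→ₗ[F] F) (η : V [⋀^Fin n]→ₗ[F] F) :
    V [⋀^Fin (m + n)]→ₗ[F] F :=
  ((TensorProduct.lid F F).toLinearMap.compAlternatingMap
    (ω.domCoprod η)).domDomCongr finSumFinEquiv

theorem det_fin_four_block {R : Type*} [CommRing R] (x b p q r s : R) :
    (!![x - b, 0, r, s;
        0, x - b, -p, -q;
        -q, -s, x + b, 0;
        p, r, 0, x + b] : Matrix (Fin 4) (Fin 4) R).det =
      (x ^ 2 + (q * r - b ^ 2 - p * s)) ^ 2 := by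
  simp [Matrix.det_succ_row_zero (n := 3), Fin.sum_univ_succ, Matrix.det_fin_three, Fin.succAbove]
  ring

theorem det_fin_six_block {R : Type*} [CommRing R] (x a₁ a₂ a₃ a₄ b p q r s : R) :
    (!![x, 0, a₁, a₂, a₃, a₄;
        0, x, 0, 0, 0, 0;
        0, -a₂, x - b, 0, r, s;
        0, a₁, 0, x - b, -p, -q;
        0, -a₄, -q, -s, x + b, 0;
        0, a₃, p, r, 0, x + b] : Matrix (Fin 6) (Fin 6) R).det =
      x ^ 2 * (x ^ 2 + (q * r - b ^ 2 - p * s)) ^ 2 := by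
  rw [← det_fin_four_block, Matrix.det_succ_column_zero,
    Finset.sum_eq_single 0 (fun i _ hi => by fin_cases i <;> simp at hi ⊢) (by simp),
    Matrix.det_succ_row_zero,
    Finset.sum_eq_single 0 (fun i _ hi => by fin_cases i <;> simp at hi ⊢) (by simp),
    Matrix.submatrix_submatrix]
  have : ∀ A B : Matrix (Fin 4) (Fin 4) R, A = B → x * (x * A.det) = x ^ 2 * B.det := by
    rintro A _ rfl; ring
  simp only [Fin.val_zero, pow_zero, one_mul]
  refine this _ _ ?_
  ext i j
  fin_cases i <;> fin_cases j <;> rfl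

open Polynomial in
theorem charpoly_block {R : Type*} [CommRing R] (a₁ a₂ a₃ a₄ b p q r s : R) :
    (!![0, 0, -a₁, -a₂, -a₃, -a₄;
        0, 0, 0, 0, 0, 0;
        0, a₂, b, 0, -r, -s;
        0, -a₁, 0, b, p, q;
        0, a₄, q, s, -b, 0;
        0, -a₃, -p, -r, 0, -b] : Matrix (Fin 6) (Fin 6) R).charpoly =
      X ^ 2 * (X ^ 2 + C (q * r - b ^ 2 - p * s)) ^ 2 := by
  have := det_fin_six_block X (C a₁) (C a₂) (C a₃) (C a₄) (C b) (C p) (C q) (C r) (C s)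
  simp only [map_sub, map_mul, map_pow]
  rw [← this, Matrix.charpoly]
  congr 1
  ext i j : 1
  fin_cases i <;> fin_cases j <;> simp [Matrix.charmatrix]

theorem sum_perm_fin_succ {M : Type*} [AddCommMonoid M] {n : ℕ}
    (g : Equiv.Perm (Fin (n + 1)) → M) :
    ∑ σ, g σ = ∑ i, ∑ τ, g (Equiv.Perm.decomposeFin.symm (i, τ)) := by
  rw [← Fintype.sum_prod_type', ← Equiv.Perm.decomposeFin.symm.sum_comp]

set_option maxRecDepth 10000 in
theorem sum_perm_fin_five_sign_mul {F : Type*} [CommRing F]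
    (f : Fin 5 → Fin 5 → Fin 5 → F) (g : Fin 5 → Fin 5 → F)
    (hf₁ : ∀ i j k, f j i k = -f i j k) (hf₂ : ∀ i j k, f i k j = -f i j k)
    (hg : ∀ i j, g j i = -g i j) (h₀ : ∀ i, i ≠ 0 → g 0 i = 0)
    (h₁₂ : g 1 2 = 1) (h₃₄ : g 3 4 = 1)
    (h₁₃ : g 1 3 = 0) (h₁₄ : g 1 4 = 0) (h₂₃ : g 2 3 = 0) (h₂₄ : g 2 4 = 0) :
    ∑ σ : Equiv.Perm (Fin 5), ((Equiv.Perm.sign σ : ℤ) : F) *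
        (f (σ 0) (σ 1) (σ 2) * g (σ 3) (σ 4)) = 12 * (f 0 1 2 + f 0 3 4) := by
  have c1 : (1 : Fin 5) = Fin.succ 0 := rfl
  have c2 : (2 : Fin 5) = Fin.succ (Fin.succ 0) := rfl
  have c3 : (3 : Fin 5) = Fin.succ (Fin.succ (Fin.succ 0)) := rfl
  have c4 : (4 : Fin 5) = Fin.succ (Fin.succ (Fin.succ (Fin.succ 0))) := rfl
  have d : (default : Equiv.Perm (Fin 1)) 0 = 0 := rfl
  have d' : Equiv.Perm.sign (default : Equiv.Perm (Fin 1)) = 1 := rfl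
  have g₀ (i : Fin 5) (hi : i ≠ 0) : g i 0 = 0 := by rw [hg, h₀ i hi, neg_zero]
  have g₂₁ : g 2 1 = -1 := by rw [hg, h₁₂]
  have g₄₃ : g 4 3 = -1 := by rw [hg, h₃₄]
  have g₃₁ : g 3 1 = 0 := by rw [hg, h₁₃, neg_zero]
  have g₄₁ : g 4 1 = 0 := by rw [hg, h₁₄, neg_zero]
  have g₃₂ : g 3 2 = 0 := by rw [hg, h₂₃, neg_zero]
  have g₄₂ : g 4 2 = 0 := by rw [hg, h₂₄, neg_zero]
  have t (a b c) : f a c b = - f a b c ∧ f b a c = - f a b c ∧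
      f b c a = f a b c ∧ f c a b = f a b c ∧ f c b a = - f a b c := by
    refine ⟨hf₂ a b c, hf₁ a b c, ?_, ?_, ?_⟩
    · rw [hf₂, hf₁, neg_neg]
    · rw [hf₁, hf₂, neg_neg]
    · rw [hf₂, hf₁, hf₂, neg_neg]
  obtain ⟨s₁, s₂, s₃, s₄, s₅⟩ := t 0 1 2
  obtain ⟨t₁, t₂, t₃, t₄, t₅⟩ := t 0 3 4
  generalize hR : 12 * (f 0 1 2 + f 0 3 4) = R
  simp only [c1, c2, c3, c4]
  simp only [sum_perm_fin_succ, Fintype.sum_unique, Equiv.Perm.decomposeFin.symm_sign,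
    Equiv.Perm.decomposeFin_symm_apply_zero, Equiv.Perm.decomposeFin_symm_apply_succ]
  simp only [Fin.sum_univ_five, Fin.sum_univ_four, Fin.sum_univ_three, Fin.sum_univ_two, d, d',
    Equiv.swap_apply_def, Fin.reduceSucc, Fin.reduceEq, if_true, if_false, Fin.isValue,
    Fin.succ_zero_eq_one]
  simp only [h₀, g₀, ne_eq, Fin.reduceEq, not_false_eq_true, h₁₂, h₃₄, h₁₃, h₁₄, h₂₃, h₂₄,
    g₂₁, g₄₃, g₃₁, g₄₁, g₃₂, g₄₂, mul_zero, add_zero, zero_add, mul_one, one_mul,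
    s₁, s₂, s₃, s₄, s₅, t₁, t₂, t₃, t₄, t₅, mul_neg, neg_neg, Units.val_neg, Units.val_one,
    Int.cast_neg, Int.cast_one, neg_mul]
  rw [← hR]
  ring

theorem smul_wedgeForm_apply {F V : Type*} [CommRing F] [AddCommGroup V] [Module F V]
    {m n : ℕ} (θ : V [⋀^Fin m]→ₗ[F] F) (Ω : V [⋀^Fin n]→ₗ[F] F) (w : Fin (m + n) → V) :
    (m.factorial * n.factorial : F) * wedgeForm θ Ω w =
      ∑ σ : Equiv.Perm (Fin (m + n)), ((Equiv.Perm.sign σ : ℤ) : F) *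
        (θ (fun i => w (σ (Fin.castAdd n i))) * Ω (fun i => w (σ (Fin.natAdd m i)))) := by
  have h := congrArg (fun f => TensorProduct.lid F F (f (w ∘ finSumFinEquiv)))
    (MultilinearMap.domCoprod_alternization_eq θ Ω)
  have h' : TensorProduct.lid F F ((((Fintype.card (Fin m)).factorial *
      (Fintype.card (Fin n)).factorial) • θ.domCoprod Ω) (w ∘ finSumFinEquiv)) =
      (m.factorial * n.factorial : F) * wedgeForm θ Ω w := by
    rw [AlternatingMap.smul_apply, map_nsmul, nsmul_eq_mul, Fintype.card_fin, Fintype.card_fin,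
      Nat.cast_mul]
    rfl
  rw [← h', ← h, ← (finSumFinEquiv.permCongr (α' := Fin m ⊕ Fin n)).sum_comp,
    MultilinearMap.alternatization_apply, map_sum]
  refine Finset.sum_congr rfl fun σ _ => ?_
  rw [Equiv.Perm.sign_permCongr, Units.smul_def, map_zsmul, zsmul_eq_mul]
  simp

theorem wedgeForm_three_two_apply {F V : Type*} [Field F] [AddCommGroup V] [Module F V]
    (hchar2 : (2 : F) ≠ 0) (hchar3 : (3 : F) ≠ 0)
    (θ : V [⋀^Fin 3]→ₗ[F] F) (Ω : V [⋀^Fin 2]→ₗ[F] F) (v e₂ f₂ e₃ f₃ : V)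
    (hv₁ : Ω ![v, e₂] = 0) (hv₂ : Ω ![v, f₂] = 0) (hv₃ : Ω ![v, e₃] = 0) (hv₄ : Ω ![v, f₃] = 0)
    (h₂ : Ω ![e₂, f₂] = 1) (h₃ : Ω ![e₃, f₃] = 1)
    (h₂₃ : Ω ![e₂, e₃] = 0) (h₂₃' : Ω ![e₂, f₃] = 0)
    (h₃₂ : Ω ![f₂, e₃] = 0) (h₃₂' : Ω ![f₂, f₃] = 0) :
    wedgeForm θ Ω ![v, e₂, f₂, e₃, f₃] = θ ![v, e₂, f₂] + θ ![v, e₃, f₃] := by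
  have eΩ (f : Fin 2 → V) : Ω f = Ω ![f 0, f 1] := by
    congr 1; ext i; fin_cases i <;> rfl
  have eθ (f : Fin 3 → V) : θ f = θ ![f 0, f 1, f 2] := by
    congr 1; ext i; fin_cases i <;> rfl
  set w : Fin 5 → V := ![v, e₂, f₂, e₃, f₃] with hw
  have h := smul_wedgeForm_apply θ Ω w
  have key := sum_perm_fin_five_sign_mul (fun i j k => θ ![w i, w j, w k])
    (fun i j => Ω ![w i, w j]) (fun i j k => ?_) (fun i j k => ?_) (fun i j => ?_) ?_
    h₂ h₃ h₂₃ h₂₃' h₃₂ h₃₂'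
  · have h12 : (12 : F) ≠ 0 := by
      rw [show (12 : F) = 2 * 2 * 3 by norm_num]
      exact mul_ne_zero (mul_ne_zero hchar2 hchar2) hchar3
    refine mul_left_cancel₀ h12 (Eq.trans ?_ ((h.trans (Finset.sum_congr rfl fun σ _ => ?_)).trans key))
    · norm_num [Nat.factorial]
    · rw [eΩ, eθ]
      rfl
  · rw [← θ.map_swap ![w i, w j, w k] (show (0 : Fin 3) ≠ 1 by decide)]
    congr 1; ext i; fin_cases i <;> rfl
  · rw [← θ.map_swap ![w i, w j, w k] (show (1 : Fin 3) ≠ 2 by decide)]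
    congr 1; ext i; fin_cases i <;> rfl
  · rw [← Ω.map_swap ![w i, w j] (show (0 : Fin 2) ≠ 1 by decide)]
    congr 1; ext i; fin_cases i <;> rfl
  · intro i hi
    fin_cases i
    · exact absurd rfl hi
    · exact hv₁
    · exact hv₂
    · exact hv₃
    · exact hv₄

theorem exists_ne_zero_forall_apply_eq_zero {F V : Type*} [Field F] [AddCommGroup V] [Module F V]
    [FiniteDimensional F V] {k : ℕ} (hk : k < Module.finrank F V) (φ : Fin k → V →ₗ[F] F) :
    ∃ x : V, x ≠ 0 ∧ ∀ i, φ i x = 0 := by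
  obtain ⟨x, hx, hx0⟩ := (Submodule.ne_bot_iff _).1
    (LinearMap.ker_ne_bot_of_finrank_lt (f := LinearMap.pi φ) (by simpa using hk))
  exact ⟨x, hx0, fun i => congrFun hx i⟩

/-- A nonzero vector extends to a symplectic basis of a six-dimensional symplectic space. -/
theorem exists_symplectic_basis {F V : Type*} [Field F] [AddCommGroup V] [Module F V]
    [FiniteDimensional F V] (hdim : Module.finrank F V = 6) (B : V →ₗ[F] V →ₗ[F] F)
    (hB : B.IsAlt) (hnd : ∀ x, (∀ y, B x y = 0) → x = 0) {v : V} (hv : v ≠ 0) :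
    ∃ b : Module.Basis (Fin 6) F V, b 0 = v ∧ ∀ i j, B (b i) (b j) =
      (!![0, 1, 0, 0, 0, 0;
          -1, 0, 0, 0, 0, 0;
          0, 0, 0, 1, 0, 0;
          0, 0, -1, 0, 0, 0;
          0, 0, 0, 0, 0, 1;
          0, 0, 0, 0, -1, 0] : Matrix (Fin 6) (Fin 6) F) i j := by
  have hs (x y : V) : B y x = - B x y := (hB.neg x y).symm
  have partner (x : V) (hx : x ≠ 0) : ∃ y, B x y = 1 := by
    obtain ⟨y, hy⟩ : ∃ y, B x y ≠ 0 := by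
      by_contra! h
      exact hx (hnd x h)
    exact ⟨(B x y)⁻¹ • y, by simp [hy]⟩
  have proj (e f w : V) (hef : B e f = 1) : ∃ w', B e w' = 0 ∧ B f w' = 0 ∧
      ∀ x, B e x = 0 → B f x = 0 → B x w' = B x w := by
    refine ⟨w - B w f • e + B w e • f, ?_, ?_, fun x h₁ h₂ => ?_⟩
    · simp [hef, hB e, hs e w]
    · simp [hs e f, hef, hB f, hs f w]
    · simp [hs e x, hs f x, h₁, h₂]
  obtain ⟨f₁, h₁⟩ := partner v hv
  obtain ⟨e₂, e₂0, he₂⟩ := exists_ne_zero_forall_apply_eq_zero (k := 2) (by omega) ![B v, B f₁]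
  simp only [Fin.forall_fin_two, Matrix.cons_val_zero, Matrix.cons_val_one] at he₂
  obtain ⟨p₁, p₂⟩ := he₂
  obtain ⟨w, hw⟩ := partner e₂ e₂0
  obtain ⟨f₂, q₁, q₂, hf₂⟩ := proj v f₁ w h₁
  have h₂ : B e₂ f₂ = 1 := by rw [hf₂ _ p₁ p₂, hw]
  obtain ⟨e₃, e₃0, he₃⟩ := exists_ne_zero_forall_apply_eq_zero (k := 4) (by omega)
    ![B v, B f₁, B e₂, B f₂]
  have r₁ : B v e₃ = 0 := he₃ 0
  have r₂ : B f₁ e₃ = 0 := he₃ 1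
  have r₃ : B e₂ e₃ = 0 := he₃ 2
  have r₄ : B f₂ e₃ = 0 := he₃ 3
  obtain ⟨w, hw⟩ := partner e₃ e₃0
  obtain ⟨w', t₁, t₂, hw'⟩ := proj v f₁ w h₁
  obtain ⟨f₃, s₃, s₄, hf₃⟩ := proj e₂ f₂ w' h₂
  have h₃ : B e₃ f₃ = 1 := by rw [hf₃ _ r₃ r₄, hw' _ r₁ r₂, hw]
  have s₁ : B v f₃ = 0 := by rw [hf₃ _ (by rw [hs, p₁, neg_zero]) (by rw [hs, q₁, neg_zero]), t₁]
  have s₂ : B f₁ f₃ = 0 := by rw [hf₃ _ (by rw [hs, p₂, neg_zero]) (by rw [hs, q₂, neg_zero]), t₂]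
  let c : Fin 6 → V := ![v, f₁, e₂, f₂, e₃, f₃]
  have hc : ∀ i j, B (c i) (c j) =
      (!![0, 1, 0, 0, 0, 0;
          -1, 0, 0, 0, 0, 0;
          0, 0, 0, 1, 0, 0;
          0, 0, -1, 0, 0, 0;
          0, 0, 0, 0, 0, 1;
          0, 0, 0, 0, -1, 0] : Matrix (Fin 6) (Fin 6) F) i j := by
    intro i j
    fin_cases i <;> fin_cases j <;>
      simp [c, hB _, h₁, h₂, h₃, p₁, p₂, q₁, q₂, r₁, r₂, r₃, r₄, s₁, s₂, s₃, s₄, hs v f₁, hs v e₂,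
        hs v f₂, hs v e₃, hs v f₃, hs f₁ e₂, hs f₁ f₂, hs f₁ e₃, hs f₁ f₃, hs e₂ f₂, hs e₂ e₃,
        hs e₂ f₃, hs f₂ e₃, hs f₂ f₃, hs e₃ f₃]
  have li : LinearIndependent F c := by
    rw [Fintype.linearIndependent_iff]
    intro g hg
    have h (i : Fin 6) : ∑ j, g j * B (c i) (c j) = 0 := by
      simpa using congrArg (B (c i)) hg
    simp only [hc, Fin.sum_univ_six] at h
    intro i
    fin_cases i
    · simpa using h 1
    · simpa using h 0
    · simpa using h 3
    · simpa using h 2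
    · simpa using h 5
    · simpa using h 4
  refine ⟨basisOfLinearIndependentOfCardEqFinrank li (by simp [hdim]), by simp [c], ?_⟩
  simpa using hc

theorem stmt_11 (F V : Type*) [Field F] [AddCommGroup V] [Module F V]
    [FiniteDimensional F V] (hdim : Module.finrank F V = 6)
    (hchar2 : (2 : F) ≠ 0) (hchar3 : (3 : F) ≠ 0)
    (Ω : V [⋀^Fin 2]→ₗ[F] F)
    (hΩ : ∀ x : V, (∀ y : V, Ω ![x, y] = 0) → x = 0)
    (θ : V [⋀^Fin 3]→ₗ[F] F)
    (J : V [⋀^Fin 2]→ₗ[F] V)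
    (hJ : ∀ x y z : V, θ ![x, y, z] = Ω ![J ![x, y], z])
    (v : V)
    (hv : (wedgeForm (wedgeForm Ω Ω) Ω : V [⋀^Fin 6]→ₗ[F] F).curryLeft v
        = (wedgeForm θ Ω : V [⋀^Fin 5]→ₗ[F] F))
    (L : V →ₗ[F] V) (hL : ∀ y : V, L y = J ![v, y]) :
    L.charpoly.coeff 5 = 0 ∧ L.charpoly.coeff 3 = 0 ∧
    L.charpoly.coeff 1 = 0 ∧ L.charpoly.coeff 0 = 0 ∧
    L.charpoly.coeff 2 = (L.charpoly.coeff 4) ^ 2 / 4 := by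
  suffices h : ∃ k : F, L.charpoly =
      Polynomial.X ^ 2 * (Polynomial.X ^ 2 + Polynomial.C k) ^ 2 by
    obtain ⟨k, hk⟩ := h
    have h4 : (4 : F) ≠ 0 := by
      rw [show (4 : F) = 2 * 2 by norm_num]; exact mul_ne_zero hchar2 hchar2
    have : L.charpoly = Polynomial.X ^ 6 + Polynomial.C (2 * k) * Polynomial.X ^ 4 +
        Polynomial.C (k ^ 2) * Polynomial.X ^ 2 := by
      rw [hk]; simp only [map_mul, map_pow, map_ofNat]; ring
    rw [this]
    simp only [Polynomial.coeff_add, Polynomial.coeff_C_mul, Polynomial.coeff_X_pow]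
    norm_num
    field_simp
    norm_num
  by_cases hv0 : v = 0
  · have hL0 : L = 0 := by
      ext y
      rw [hL, hv0]
      exact J.map_coord_zero 0 rfl
    exact ⟨0, by rw [hL0, LinearMap.charpoly_zero, hdim]; simp; ring⟩
  have Ωs (x y : V) : Ω ![y, x] = - Ω ![x, y] := by
    rw [← Ω.map_swap ![x, y] (show (0 : Fin 2) ≠ 1 by decide)]
    congr 1; ext i; fin_cases i <;> rfl
  let B : V →ₗ[F] V →ₗ[F] F := LinearMap.mk₂ F (fun x y => Ω ![x, y])
    (fun x x' y => Ω.map_vecCons_add _ _ _) (fun c x y => Ω.map_vecCons_smul _ _ _)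
    (fun x y y' => by simp only [Ωs _ x, Ω.map_vecCons_add, neg_add])
    (fun c x y => by simp only [Ωs _ x, Ω.map_vecCons_smul, smul_neg])
  have hBΩ (x y : V) : B x y = Ω ![x, y] := rfl
  have hB : B.IsAlt := fun x => Ω.map_eq_zero_of_eq ![x, x] (i := 0) (j := 1) rfl (by decide)
  obtain ⟨b, hb0, hb⟩ := exists_symplectic_basis hdim B hB hΩ hv0
  let T : V → V → F := fun y z => θ ![v, y, z]
  have hT (y z : V) : B (L y) z = T y z := by rw [hBΩ, hL, ← hJ]
  have Ts (y z : V) : T z y = - T y z := by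
    simp only [T]
    rw [← θ.map_swap ![v, y, z] (show (1 : Fin 3) ≠ 2 by decide)]
    congr 1; ext i; fin_cases i <;> rfl
  have Ta (y : V) : T y y = 0 :=
    θ.map_eq_zero_of_eq ![v, y, y] (i := 1) (j := 2) rfl (by decide)
  have T0 (y : V) : T (b 0) y = 0 :=
    θ.map_eq_zero_of_eq ![v, b 0, y] (i := 0) (j := 1) hb0.symm (by decide)
  have T0' (y : V) : T y (b 0) = 0 := by rw [Ts, T0, neg_zero]
  have tr : T (b 2) (b 3) + T (b 4) (b 5) = 0 := by
    have h := congrArg (fun f => f ![v, b 2, b 3, b 4, b 5]) hv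
    simp only [AlternatingMap.curryLeft_apply_apply] at h
    rw [AlternatingMap.map_eq_zero_of_eq (i := 0) (j := 1) _ _ rfl (by decide)] at h
    have h' := wedgeForm_three_two_apply hchar2 hchar3 θ Ω v (b 2) (b 3) (b 4) (b 5)
    simp only [← hBΩ, ← hb0, hb] at h'
    rw [hb0] at h'
    rw [h, ← h'] <;> simp
  have hrepr (y : V) (j : Fin 6) : B y (b j) = ∑ i, b.repr y i * B (b i) (b j) := by
    conv_lhs => rw [← b.sum_repr y]
    simp only [map_sum, map_smul, LinearMap.sum_apply, LinearMap.smul_apply, smul_eq_mul]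
  have hM : LinearMap.toMatrix b b L =
      !![0, 0, -T (b 1) (b 2), -T (b 1) (b 3), -T (b 1) (b 4), -T (b 1) (b 5);
         0, 0, 0, 0, 0, 0;
         0, T (b 1) (b 3), T (b 2) (b 3), 0, -T (b 3) (b 4), -T (b 3) (b 5);
         0, -T (b 1) (b 2), 0, T (b 2) (b 3), T (b 2) (b 4), T (b 2) (b 5);
         0, T (b 1) (b 5), T (b 2) (b 5), T (b 3) (b 5), -T (b 2) (b 3), 0;
         0, -T (b 1) (b 4), -T (b 2) (b 4), -T (b 3) (b 4), 0, -T (b 2) (b 3)] := by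
    have h45 : T (b 4) (b 5) = -T (b 2) (b 3) := by linear_combination tr
    ext i j
    rw [LinearMap.toMatrix_apply]
    have h (k : Fin 6) := hrepr (L (b j)) k
    simp only [hb, hT, Fin.sum_univ_six] at h
    have r0 : b.repr (L (b j)) 0 = T (b j) (b 1) := by simpa using (h 1).symm
    have r1 : b.repr (L (b j)) 1 = -T (b j) (b 0) := by simp [h 0]
    have r2 : b.repr (L (b j)) 2 = T (b j) (b 3) := by simpa using (h 3).symm
    have r3 : b.repr (L (b j)) 3 = -T (b j) (b 2) := by simp [h 2]
    have r4 : b.repr (L (b j)) 4 = T (b j) (b 5) := by simpa using (h 5).symm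
    have r5 : b.repr (L (b j)) 5 = -T (b j) (b 4) := by simp [h 4]
    clear h
    fin_cases i <;> simp [r0, r1, r2, r3, r4, r5] <;> clear r0 r1 r2 r3 r4 r5 <;>
      fin_cases j <;>
      simp [T0, T0', Ta, h45, Ts (b 1) (b 2), Ts (b 1) (b 3), Ts (b 1) (b 4), Ts (b 1) (b 5),
        Ts (b 2) (b 3), Ts (b 2) (b 4), Ts (b 2) (b 5), Ts (b 3) (b 4), Ts (b 3) (b 5),
        Ts (b 4) (b 5)]
  rw [← LinearMap.charpoly_toMatrix L b, hM]
  exact ⟨_, charpoly_block ..⟩
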